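/- Let Y be a random variable taking values in [0,∞) with distribution function G having finite moments ν_n = E[Y^n] of all positive integer orders, such that G is absolutely continuous on [x₀,∞) for some x₀ > 1, with density g(x) = G′(x) > 0 there. Let a > 0 and α ∈ [0,1]. If limsup_{x→∞} g((x + a·(log x)^α)²) / g(x²) < 1, then ∑_{n=1}^∞ ν_n^{−1/(2n)} = ∞ and G is uniquely determined by its moments among all probability distributions on [0,∞). -/

import Mathlib

open MeasureTheory Filter Set

/-- Moment-determinacy on `ℝ₊` among all probability distributions on `[0,∞)`. -/
def IsMomentDetOnNonneg (μ : Measure ℝ) : Prop :=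
  ∀ ν : Measure ℝ, IsProbabilityMeasure ν → ν (Set.Iio 0) = 0 →
    (∀ n : ℕ, 0 < n → Integrable (fun x => x ^ n) ν ∧
      ∫ x, x ^ n ∂ν = ∫ x, x ^ n ∂μ) → ν = μ

/-- **Carleman's inequality** for a finite sequence of positive numbers. -/
theorem carleman_inequality (a : ℕ → ℝ) (ha : ∀ n, 0 < a n) (N : ℕ) :
    ∑ n ∈ Finset.range N, (∏ k ∈ Finset.range (n + 1), a k) ^ (1 / ((n : ℝ) + 1)) ≤
      Real.exp 1 * ∑ k ∈ Finset.range N, a k := by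
  set c : ℕ → ℝ := fun k => ((k : ℝ) + 2) ^ (k + 1) / ((k : ℝ) + 1) ^ k with hc
  have hc_pos : ∀ k, 0 < c k := fun k => by simp only [hc]; positivity
  have hc_prod : ∀ n, ∏ k ∈ Finset.range n, c k = ((n : ℝ) + 1) ^ n := by
    intro n
    induction n with
    | zero => simp
    | succ n ih =>
      rw [Finset.prod_range_succ, ih]
      simp only [hc]
      push_cast
      have : ((n : ℝ) + 1) ^ n ≠ 0 := by positivity
      field_simp
      ring
  have hc_le : ∀ k, c k / ((k : ℝ) + 1) ≤ Real.exp 1 := by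
    intro k
    have hk : (0 : ℝ) < (k : ℝ) + 1 := by positivity
    have h1 : c k / ((k : ℝ) + 1) = (1 / ((k : ℝ) + 1) + 1) ^ (k + 1) := by
      have : 1 / ((k : ℝ) + 1) + 1 = ((k : ℝ) + 2) / ((k : ℝ) + 1) := by field_simp; ring
      rw [this, div_pow, pow_succ ((k : ℝ) + 1), ← div_div]
    rw [h1]
    calc (1 / ((k : ℝ) + 1) + 1) ^ (k + 1) ≤ (Real.exp (1 / ((k : ℝ) + 1))) ^ (k + 1) := by
          gcongr
          exact Real.add_one_le_exp _
      _ = Real.exp 1 := by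
          rw [← Real.exp_nat_mul]
          congr 1
          push_cast
          field_simp
  have hgm : ∀ n : ℕ, (∏ k ∈ Finset.range (n + 1), a k) ^ (1 / ((n : ℝ) + 1)) ≤
      (∑ k ∈ Finset.range (n + 1), a k * c k) / (((n : ℝ) + 1) * ((n : ℝ) + 2)) := by
    intro n
    have hn : (0 : ℝ) < (n : ℝ) + 1 := by positivity
    have key := Real.geom_mean_le_arith_mean_weighted (Finset.range (n + 1))
      (fun _ => 1 / ((n : ℝ) + 1)) (fun k => a k * c k) (fun _ _ => by positivity)
      (by simp; field_simp) (fun k _ => (mul_pos (ha k) (hc_pos k)).le)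
    rw [Real.finsetProd_rpow _ _ (fun k _ => (mul_pos (ha k) (hc_pos k)).le),
      Finset.prod_mul_distrib, hc_prod, ← Finset.mul_sum,
      Real.mul_rpow (Finset.prod_nonneg fun k _ => (ha k).le) (by positivity),
      ← Real.rpow_natCast, ← Real.rpow_mul (by positivity)] at key
    have h2 : ((n + 1 : ℕ) : ℝ) * (1 / ((n : ℝ) + 1)) = 1 := by push_cast; field_simp
    rw [h2, Real.rpow_one] at key
    push_cast at key
    rw [le_div_iff₀ (by positivity)]
    have h3 := mul_le_mul_of_nonneg_left key hn.le
    rw [← mul_assoc ((n : ℝ) + 1) (1 / ((n : ℝ) + 1)), mul_one_div_cancel hn.ne', one_mul] at h3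
    calc _ = _ := by ring
      _ ≤ _ := h3
  have hind : ∑ n ∈ Finset.range N, (∏ k ∈ Finset.range (n + 1), a k) ^ (1 / ((n : ℝ) + 1)) +
      (∑ k ∈ Finset.range N, a k * c k) / ((N : ℝ) + 1) ≤
      ∑ k ∈ Finset.range N, a k * (c k / ((k : ℝ) + 1)) := by
    induction N with
    | zero => simp
    | succ N ih =>
      have h := hgm N
      rw [Finset.sum_range_succ (fun n => (∏ k ∈ Finset.range (n + 1), a k) ^ _),
        Finset.sum_range_succ (fun k => a k * (c k / ((k : ℝ) + 1)))]
      have e : (∑ k ∈ Finset.range (N + 1), a k * c k) / (((N : ℝ) + 1) * ((N : ℝ) + 2)) +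
          (∑ k ∈ Finset.range (N + 1), a k * c k) / (((N + 1 : ℕ) : ℝ) + 1) =
          (∑ k ∈ Finset.range N, a k * c k) / ((N : ℝ) + 1) + a N * (c N / ((N : ℝ) + 1)) := by
        rw [Finset.sum_range_succ]
        push_cast
        have : (N : ℝ) + 1 + 1 ≠ 0 := by positivity
        have : (N : ℝ) + 2 ≠ 0 := by positivity
        field_simp
        ring
      linarith
  have hnn : 0 ≤ (∑ k ∈ Finset.range N, a k * c k) / ((N : ℝ) + 1) :=
    div_nonneg (Finset.sum_nonneg fun k _ => (mul_pos (ha k) (hc_pos k)).le) (by positivity)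
  calc _ ≤ ∑ k ∈ Finset.range N, a k * (c k / ((k : ℝ) + 1)) := by linarith
    _ ≤ ∑ k ∈ Finset.range N, a k * Real.exp 1 :=
        Finset.sum_le_sum fun k _ => mul_le_mul_of_nonneg_left (hc_le k) (ha k).le
    _ = _ := by rw [← Finset.sum_mul, mul_comm]

/-- One step of **Bang's argument**: with `M` logarithmically convex, the bounds
`‖f n x‖ ≤ 2 ^ n / 2 ^ (N + 2) * M n` degrade by at most a factor two over an interval of length
proportional to `M N / M (N + 1)`. -/
theorem bang_step {E : Type*} [NormedAddCommGroup E] [NormedSpace ℝ E]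
    (f : ℕ → ℝ → E) (M : ℕ → ℝ) (hM : ∀ n, 0 < M n)
    (hconv : Monotone fun n => M (n + 1) / M n)
    (hderiv : ∀ n x, HasDerivAt (f n) (f (n + 1) x) x)
    (hbound : ∀ n x, ‖f n x‖ ≤ M n) (N : ℕ) (x y : ℝ) (hxy : x ≤ y)
    (hlen : y - x ≤ Real.log (4 / 3) / 2 * (M N / M (N + 1)))
    (hx : ∀ n, ‖f n x‖ ≤ 2 ^ n / 2 ^ (N + 2) * M n) (n : ℕ) :
    ‖f n y‖ ≤ 2 ^ n / 2 ^ (N + 1) * M n := by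
  rcases le_or_gt (N + 1) n with hn | hn
  · refine (hbound n y).trans (le_mul_of_one_le_left (hM n).le ?_)
    rw [one_le_div (by positivity)]
    exact pow_le_pow_right₀ one_le_two hn
  set r : ℝ := M (N + 1) / M N with hr
  have hr_pos : 0 < r := div_pos (hM _) (hM _)
  set u : ℝ → Fin (N + 1) → E := fun t i => (2 ^ (i : ℕ) * M i)⁻¹ • f i t with hu
  set u' : ℝ → Fin (N + 1) → E := fun t i => (2 ^ (i : ℕ) * M i)⁻¹ • f (i + 1) t with hu'
  have hw : ∀ k : ℕ, 0 < 2 ^ k * M k := fun k => mul_pos (by positivity) (hM k)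
  have hu_deriv : ∀ t, HasDerivAt u (u' t) t := fun t =>
    hasDerivAt_pi.2 fun i => (hderiv i t).const_smul _
  have hnorm : ∀ (k m : ℕ) t, ‖(2 ^ k * M k)⁻¹ • f m t‖ = ‖f m t‖ / (2 ^ k * M k) := by
    intro k m t
    rw [norm_smul, norm_inv, Real.norm_of_nonneg (hw k).le, inv_mul_eq_div]
  have hinit : ‖u x‖ ≤ (1 / 2 ^ (N + 2) : ℝ) := by
    refine (pi_norm_le_iff_of_nonneg (by positivity)).2 fun i => ?_
    simp only [hu]
    rw [hnorm, div_le_iff₀ (hw i)]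
    exact (hx i).trans_eq (by ring)
  have hgrow : ∀ t ∈ Ico x y, ‖u' t‖ ≤ 2 * r * ‖u t‖ + 2 * r * (1 / 2 ^ (N + 1)) := by
    intro t _
    have hA : 0 ≤ 2 * r * ‖u t‖ := by positivity
    have hB : 0 ≤ 2 * r * (1 / 2 ^ (N + 1)) := by positivity
    refine (pi_norm_le_iff_of_nonneg (by positivity)).2 fun i => ?_
    simp only [hu']
    rw [hnorm]
    have hMi : M (i + 1) ≤ r * M i := by
      have := hconv (show (i : ℕ) ≤ N by omega)
      rwa [div_le_iff₀ (hM i)] at this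
    rcases lt_or_ge ((i : ℕ) + 1) (N + 1) with hi | hi
    · have h1 := norm_le_pi_norm (u t) ⟨(i : ℕ) + 1, hi⟩
      simp only [hu] at h1
      rw [hnorm, div_le_iff₀ (hw _)] at h1
      have : ‖f (i + 1) t‖ / (2 ^ (i : ℕ) * M i) ≤ 2 * r * ‖u t‖ := by
        rw [div_le_iff₀ (hw i)]
        refine h1.trans ?_
        calc ‖u t‖ * (2 ^ ((i : ℕ) + 1) * M (i + 1))
            ≤ ‖u t‖ * (2 ^ ((i : ℕ) + 1) * (r * M i)) := by gcongr
          _ = _ := by ring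
      linarith
    · have hi' : (i : ℕ) = N := by omega
      have : ‖f (i + 1) t‖ / (2 ^ (i : ℕ) * M i) ≤ 2 * r * (1 / 2 ^ (N + 1)) := by
        rw [div_le_iff₀ (hw i)]
        refine (hbound _ t).trans (hMi.trans_eq ?_)
        rw [hi']
        field_simp
        ring
      linarith
  have hfin := norm_le_gronwallBound_of_norm_deriv_right_le
    (fun t _ => (hu_deriv t).continuousAt.continuousWithinAt)
    (fun t _ => (hu_deriv t).hasDerivWithinAt) hinit hgrow y ⟨hxy, le_rfl⟩
  rw [gronwallBound_of_K_ne_0 (by positivity)] at hfin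
  have hexp : Real.exp (2 * r * (y - x)) ≤ 4 / 3 := by
    rw [← Real.le_log_iff_exp_le (by norm_num)]
    calc 2 * r * (y - x) ≤ 2 * r * (Real.log (4 / 3) / 2 * (M N / M (N + 1))) := by gcongr
      _ = Real.log (4 / 3) := by
        rw [hr]
        have := (hM N).ne'
        have := (hM (N + 1)).ne'
        field_simp
  have huy : ‖u y‖ ≤ (1 / 2 ^ (N + 1) : ℝ) := by
    refine hfin.trans ?_
    simp only
    rw [mul_div_cancel_left₀ _ (by positivity : 2 * r ≠ 0)]
    have h2 : (1 / 2 ^ (N + 2) : ℝ) = 1 / 2 ^ (N + 1) / 2 := by rw [pow_succ _ (N + 1)]; ring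
    rw [h2]
    have h3 : (0 : ℝ) < 1 / 2 ^ (N + 1) := by positivity
    nlinarith
  have h4 := (norm_le_pi_norm (u y) ⟨n, hn⟩).trans huy
  simp only [hu] at h4
  rw [hnorm, div_le_iff₀ (hw n)] at h4
  exact h4.trans_eq (by ring)

/-- **Denjoy–Carleman theorem** (quasi-analyticity), following Bang: a smooth function all of
whose derivatives vanish at `0`, with the `n`-th derivative bounded by `M n`, vanishes on
`[0, ∞)` if `M` is logarithmically convex and `∑ M n / M (n + 1) = ∞`. -/
theorem eq_zero_of_quasianalytic {E : Type*} [NormedAddCommGroup E] [NormedSpace ℝ E]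
    (f : ℕ → ℝ → E) (M : ℕ → ℝ) (hM : ∀ n, 0 < M n)
    (hconv : Monotone fun n => M (n + 1) / M n)
    (hderiv : ∀ n x, HasDerivAt (f n) (f (n + 1) x) x)
    (hbound : ∀ n x, ‖f n x‖ ≤ M n) (hzero : ∀ n, f n 0 = 0)
    (hsum : Tendsto (fun N => ∑ n ∈ Finset.range N, M n / M (n + 1)) atTop atTop)
    (t : ℝ) (ht : 0 ≤ t) : f 0 t = 0 := by
  set c : ℝ := Real.log (4 / 3) / 2 with hc
  have hc_pos : 0 < c := div_pos (Real.log_pos (by norm_num)) two_pos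
  have hprop : ∀ (j K : ℕ) (s : ℝ), 0 ≤ s →
      s ≤ c * ∑ i ∈ Finset.range j, M (K + i) / M (K + i + 1) →
      ∀ n, ‖f n s‖ ≤ 2 ^ n / 2 ^ (K + 1) * M n := by
    intro j
    induction j with
    | zero =>
      intro K s hs0 hs n
      have : s = 0 := le_antisymm (by simpa using hs) hs0
      rw [this, hzero, norm_zero]
      have := hM n
      positivity
    | succ j ih =>
      intro K s hs0 hs n
      rw [Finset.sum_range_succ', mul_add] at hs
      set S := c * ∑ i ∈ Finset.range j, M (K + (i + 1)) / M (K + (i + 1) + 1) with hS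
      have hS0 : 0 ≤ S :=
        mul_nonneg hc_pos.le (Finset.sum_nonneg fun i _ => (div_pos (hM _) (hM _)).le)
      refine bang_step f M hM hconv hderiv hbound K (min s S) s (min_le_left _ _) ?_ ?_ n
      · change s - min s S ≤ c * (M K / M (K + 1))
        have h0 : 0 ≤ c * (M K / M (K + 1)) := mul_nonneg hc_pos.le (div_pos (hM _) (hM _)).le
        simp only [add_zero] at hs
        rcases le_total s S with h | h
        · rw [min_eq_left h, sub_self]
          exact h0
        · rw [min_eq_right h]
          linarith
      · refine ih (K + 1) _ (le_min hs0 hS0) ((min_le_right _ _).trans_eq ?_)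
        rw [hS]
        congr 1
        refine Finset.sum_congr rfl fun i _ => ?_
        rw [show K + (i + 1) = K + 1 + i by ring]
  have hall : ∀ K : ℕ, ‖f 0 t‖ ≤ M 0 * (1 / 2) ^ (K + 1) := by
    intro K
    obtain ⟨N, hN, hKN⟩ := ((hsum.eventually_ge_atTop
      (t / c + ∑ i ∈ Finset.range K, M i / M (i + 1))).and (eventually_ge_atTop K)).exists
    obtain ⟨j, rfl⟩ := Nat.exists_eq_add_of_le hKN
    rw [Finset.sum_range_add] at hN
    have := hprop j K t ht (by rw [← div_le_iff₀' hc_pos]; linarith) 0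
    refine this.trans_eq ?_
    rw [one_div_pow]
    ring
  have hlim : Tendsto (fun K : ℕ => M 0 * (1 / 2 : ℝ) ^ (K + 1)) atTop (nhds 0) := by
    simpa using ((tendsto_add_atTop_iff_nat 1).2
      (tendsto_pow_atTop_nhds_zero_of_lt_one (by norm_num : (0 : ℝ) ≤ 1 / 2)
        (by norm_num))).const_mul (M 0)
  exact norm_le_zero_iff.1 (ge_of_tendsto' hlim hall)

/-- The absolute moments of a finite measure are logarithmically convex. -/
theorem sq_integral_abs_pow_succ_le (ρ : Measure ℝ)
    (hint : ∀ n : ℕ, Integrable (fun x => |x| ^ n) ρ) (n : ℕ) :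
    (∫ x, |x| ^ (n + 1) ∂ρ) ^ 2 ≤ (∫ x, |x| ^ n ∂ρ) * ∫ x, |x| ^ (n + 2) ∂ρ := by
  have hquad : ∀ t : ℝ, 0 ≤ (∫ x, |x| ^ (n + 2) ∂ρ) * (t * t) +
      (-2 * ∫ x, |x| ^ (n + 1) ∂ρ) * t + ∫ x, |x| ^ n ∂ρ := by
    intro t
    have h0 : 0 ≤ ∫ x, |x| ^ n * (t * |x| - 1) ^ 2 ∂ρ :=
      integral_nonneg fun x => by positivity
    have h1 : ∫ x, |x| ^ n * (t * |x| - 1) ^ 2 ∂ρ =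
        ∫ x, (t * t * |x| ^ (n + 2) + -2 * t * |x| ^ (n + 1)) + |x| ^ n ∂ρ :=
      integral_congr_ae (.of_forall fun x => by ring)
    have i1 := (hint (n + 2)).const_mul (t * t)
    have i2 := (hint (n + 1)).const_mul (-2 * t)
    have h2 := integral_add (i1.add i2) (hint n)
    have h3 := integral_add i1 i2
    simp only [Pi.add_apply, integral_const_mul] at h2 h3
    linarith
  have h := discrim_le_zero hquad
  rw [discrim] at h
  linarith

/-- **Carleman's criterion** for the Hamburger moment problem. -/
theorem eq_of_carleman_hamburger (μ ν : Measure ℝ) [IsProbabilityMeasure μ]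
    [IsProbabilityMeasure ν] (hμ : ∀ n : ℕ, Integrable (fun x => x ^ n) μ)
    (hν : ∀ n : ℕ, Integrable (fun x => x ^ n) ν)
    (heq : ∀ n : ℕ, ∫ x, x ^ n ∂μ = ∫ x, x ^ n ∂ν)
    (hsum : Tendsto (fun N : ℕ => ∑ n ∈ Finset.Icc 1 N,
      (∫ x, x ^ (2 * n) ∂μ) ^ (-(1 : ℝ) / (2 * n))) atTop atTop) : μ = ν := by
  have habs : ∀ (ρ : Measure ℝ), (∀ n : ℕ, Integrable (fun x => x ^ n) ρ) →
      ∀ n : ℕ, Integrable (fun x => |x| ^ n) ρ := fun ρ h n => by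
    simpa [abs_pow] using (h n).abs
  have hρ : ∀ n : ℕ, Integrable (fun x => |x| ^ n) (μ + ν) := fun n =>
    (habs μ hμ n).add_measure (habs ν hν n)
  set M : ℕ → ℝ := fun n => ∫ x, |x| ^ n ∂(μ + ν) with hMdef
  have hM_even : ∀ n, M (2 * n) = 2 * ∫ x, x ^ (2 * n) ∂μ := by
    intro n
    simp only [hMdef]
    rw [integral_add_measure (habs μ hμ _) (habs ν hν _)]
    simp only [pow_mul, sq_abs]
    simp only [← pow_mul]
    rw [heq (2 * n)]
    ring
  have hM_pos : ∀ n, 0 < M n := by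
    intro n
    refine (integral_nonneg fun x => by positivity : 0 ≤ M n).lt_of_ne' fun h0 => ?_
    have hae : ∀ᵐ x ∂(μ + ν), x = 0 := by
      filter_upwards [(integral_eq_zero_iff_of_nonneg (fun x => by positivity) (hρ n)).1 h0]
        with x hx
      exact abs_eq_zero.1 (eq_zero_of_pow_eq_zero hx)
    have hae' : ∀ᵐ x ∂μ, x = 0 := (ae_add_measure_iff.1 hae).1
    refine not_tendsto_const_atTop (0 : ℝ) (atTop : Filter ℕ) (hsum.congr fun N => ?_)
    refine Finset.sum_eq_zero fun k hk => ?_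
    have hk1 : 1 ≤ k := (Finset.mem_Icc.1 hk).1
    have : ∫ x, x ^ (2 * k) ∂μ = 0 := by
      refine integral_eq_zero_of_ae ?_
      filter_upwards [hae'] with x hx
      simp [hx]
      omega
    rw [this, Real.zero_rpow]
    have : (0 : ℝ) < k := by exact_mod_cast hk1
    exact div_ne_zero (by norm_num) (by positivity)
  have hconv : Monotone fun n => M (n + 1) / M n := by
    refine monotone_nat_of_le_succ fun n => ?_
    rw [div_le_div_iff₀ (hM_pos _) (hM_pos _)]
    have := sq_integral_abs_pow_succ_le (μ + ν) hρ n
    calc M (n + 1) * M (n + 1) = M (n + 1) ^ 2 := by ring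
      _ ≤ M n * M (n + 2) := this
      _ = _ := mul_comm _ _
  have hdiv : Tendsto (fun N => ∑ n ∈ Finset.range N, M n / M (n + 1)) atTop atTop := by
    have hprod : ∀ n, ∏ k ∈ Finset.range n, M k / M (k + 1) = M 0 / M n := by
      intro n
      induction n with
      | zero => simp [(hM_pos 0).ne']
      | succ n ih => rw [Finset.prod_range_succ, ih, div_mul_div_cancel₀ (hM_pos n).ne']
    have hcarl : ∀ N : ℕ, ∑ n ∈ Finset.Icc 1 N,
        (∫ x, x ^ (2 * n) ∂μ) ^ (-(1 : ℝ) / (2 * n)) ≤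
        Real.exp 1 * ∑ n ∈ Finset.range (2 * N), M n / M (n + 1) := by
      intro N
      refine le_trans ?_ (carleman_inequality (fun n => M n / M (n + 1))
        (fun n => div_pos (hM_pos _) (hM_pos _)) (2 * N))
      simp only [hprod]
      induction N with
      | zero => simp
      | succ N ih =>
        rw [Finset.sum_Icc_succ_top (by omega), show 2 * (N + 1) = 2 * N + 1 + 1 by ring,
          Finset.sum_range_succ, Finset.sum_range_succ]
        have h1 : 0 ≤ (M 0 / M (2 * N + 1)) ^ (1 / (((2 * N : ℕ) : ℝ) + 1)) :=
          Real.rpow_nonneg (div_pos (hM_pos _) (hM_pos _)).le _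
        have h2 : (∫ x, x ^ (2 * N + 1 + 1) ∂μ) ^ (-(1 : ℝ) / (2 * (N + 1 : ℕ))) =
            (M 0 / M (2 * N + 1 + 1)) ^ (1 / (((2 * N + 1 : ℕ) : ℝ) + 1)) := by
          have e0 : M 0 = 2 := by simpa using hM_even 0
          have e1 := hM_even (N + 1)
          have e2 := hM_pos (2 * (N + 1))
          rw [show 2 * (N + 1) = 2 * N + 1 + 1 by ring] at e1 e2
          rw [e0, e1, div_mul_cancel_left₀ two_ne_zero, neg_div,
            Real.rpow_neg (by linarith), Real.inv_rpow (by linarith)]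
          congr 3
          push_cast
          ring
        linarith
    have h2N : Tendsto (fun N : ℕ => ∑ n ∈ Finset.range (2 * N), M n / M (n + 1))
        atTop atTop := by
      refine tendsto_atTop_mono (fun N => ?_) (hsum.const_mul_atTop (inv_pos.2 (Real.exp_pos 1)))
      rw [inv_mul_le_iff₀ (Real.exp_pos 1)]
      exact hcarl N
    refine tendsto_atTop.2 fun b => ?_
    obtain ⟨N, hN⟩ := (h2N.eventually_ge_atTop b).exists
    filter_upwards [eventually_ge_atTop (2 * N)] with m hm
    exact hN.trans (Finset.sum_le_sum_of_subset_of_nonneg (Finset.range_mono hm)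
      fun i _ _ => (div_pos (hM_pos _) (hM_pos _)).le)
  have hLp : ∀ (ρ : Measure ℝ) [IsFiniteMeasure ρ], (∀ n : ℕ, Integrable (fun x => x ^ n) ρ) →
      ∀ n : ℕ, MemLp id n ρ := by
    intro ρ _ h n
    rcases Nat.eq_zero_or_pos n with rfl | hn
    · simpa using measurable_id.aestronglyMeasurable
    · rw [← integrable_norm_rpow_iff measurable_id.aestronglyMeasurable (by simpa using hn.ne')
        (by simp)]
      simpa using habs ρ h n
  set f : ℕ → ℝ → ℂ := fun n t =>
    iteratedDeriv n (charFun μ) t - iteratedDeriv n (charFun ν) t with hf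
  have hderiv : ∀ n x, HasDerivAt (f n) (f (n + 1) x) x := by
    intro n x
    have h : ∀ (ρ : Measure ℝ) [IsFiniteMeasure ρ], (∀ n : ℕ, Integrable (fun x => x ^ n) ρ) →
        HasDerivAt (iteratedDeriv n (charFun ρ)) (iteratedDeriv (n + 1) (charFun ρ) x) x := by
      intro ρ _ h
      rw [iteratedDeriv_succ]
      exact ((contDiff_charFun (n := n + 1) (hLp ρ h (n + 1))).differentiable_iteratedDeriv n
        (by exact_mod_cast n.lt_succ_self) x).hasDerivAt
    exact (h μ hμ).sub (h ν hν)
  have hbound : ∀ n x, ‖f n x‖ ≤ M n := by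
    intro n x
    have h : ∀ (ρ : Measure ℝ) [IsFiniteMeasure ρ], (∀ n : ℕ, Integrable (fun x => x ^ n) ρ) →
        ‖iteratedDeriv n (charFun ρ) x‖ ≤ ∫ y, |y| ^ n ∂ρ := by
      intro ρ _ h
      rw [iteratedDeriv_charFun (hLp ρ h n), norm_mul, norm_pow, Complex.norm_I, one_pow, one_mul]
      refine (norm_integral_le_integral_norm _).trans_eq (integral_congr_ae (.of_forall fun y => ?_))
      simp only [norm_mul, norm_pow, Complex.norm_real, Real.norm_eq_abs]
      rw [← Complex.ofReal_mul, Complex.norm_exp_ofReal_mul_I, mul_one]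
    simp only [hMdef]
    rw [integral_add_measure (habs μ hμ _) (habs ν hν _)]
    exact (norm_sub_le _ _).trans (add_le_add (h μ hμ) (h ν hν))
  have hzero : ∀ n, f n 0 = 0 := by
    intro n
    simp only [hf]
    rw [iteratedDeriv_charFun_zero (hLp μ hμ n), iteratedDeriv_charFun_zero (hLp ν hν n), heq n,
      sub_self]
  have hpos : ∀ t, 0 ≤ t → charFun μ t = charFun ν t := by
    intro t ht
    have := eq_zero_of_quasianalytic f M hM_pos hconv hderiv hbound hzero hdiv t ht
    simpa [hf, sub_eq_zero] using this
  refine Measure.ext_of_charFun (funext fun t => ?_)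
  rcases le_total 0 t with ht | ht
  · exact hpos t ht
  · rw [← neg_neg t, charFun_neg, charFun_neg (μ := ν), hpos (-t) (by linarith)]

/-- The symmetric law on `ℝ` whose image under squaring is the law `μ` on `[0, ∞)`. -/
noncomputable def symmSqrt (μ : Measure ℝ) : Measure ℝ :=
  (2⁻¹ : ENNReal) • (μ.map Real.sqrt + μ.map fun y => -Real.sqrt y)

theorem measurable_neg_sqrt : Measurable fun y : ℝ => -Real.sqrt y :=
  Real.continuous_sqrt.measurable.neg

instance isProbabilityMeasure_symmSqrt (μ : Measure ℝ) [IsProbabilityMeasure μ] :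
    IsProbabilityMeasure (symmSqrt μ) := by
  have h1 := Measure.isProbabilityMeasure_map (μ := μ)
    Real.continuous_sqrt.measurable.aemeasurable
  have h2 := Measure.isProbabilityMeasure_map (μ := μ) measurable_neg_sqrt.aemeasurable
  constructor
  simp only [symmSqrt, Measure.smul_apply, Measure.add_apply, measure_univ, smul_eq_mul]
  rw [one_add_one_eq_two]
  exact ENNReal.inv_mul_cancel two_ne_zero ENNReal.ofNat_ne_top

theorem ae_nonneg_of_measure_Iio_eq_zero {μ : Measure ℝ} (h : μ (Iio 0) = 0) :
    ∀ᵐ y ∂μ, 0 ≤ y := by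
  rw [ae_iff]
  simp only [not_le]
  exact h

theorem map_sq_symmSqrt (μ : Measure ℝ) (h : μ (Iio 0) = 0) :
    (symmSqrt μ).map (fun x => x ^ 2) = μ := by
  have hsq : Measurable fun x : ℝ => x ^ 2 := by fun_prop
  have h1 : (μ.map Real.sqrt).map (fun x => x ^ 2) = μ := by
    rw [Measure.map_map hsq Real.continuous_sqrt.measurable]
    conv_rhs => rw [← Measure.map_id (μ := μ)]
    refine Measure.map_congr ?_
    filter_upwards [ae_nonneg_of_measure_Iio_eq_zero h] with y hy
    simp [Real.sq_sqrt hy]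
  have h2 : (μ.map fun y => -Real.sqrt y).map (fun x => x ^ 2) = μ := by
    rw [Measure.map_map hsq measurable_neg_sqrt]
    conv_rhs => rw [← Measure.map_id (μ := μ)]
    refine Measure.map_congr ?_
    filter_upwards [ae_nonneg_of_measure_Iio_eq_zero h] with y hy
    simp [Real.sq_sqrt hy]
  rw [symmSqrt, Measure.map_smul, Measure.map_add _ _ hsq, h1, h2, ← two_smul ENNReal μ, smul_smul,
    ENNReal.inv_mul_cancel two_ne_zero ENNReal.ofNat_ne_top, one_smul]

theorem integrable_sqrt_pow (μ : Measure ℝ) [IsFiniteMeasure μ] (n : ℕ)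
    (h : Integrable (fun x => x ^ n) μ) : Integrable (fun y => Real.sqrt y ^ n) μ := by
  refine ((integrable_const (1 : ℝ)).add h.abs).mono'
    (Real.continuous_sqrt.pow n).aestronglyMeasurable (.of_forall fun y => ?_)
  simp only [Real.norm_eq_abs, Pi.add_apply, abs_pow, abs_of_nonneg (Real.sqrt_nonneg y)]
  rcases le_total |y| 1 with hy | hy
  · have h1 : Real.sqrt y ≤ 1 := Real.sqrt_le_one.2 ((le_abs_self y).trans hy)
    have := pow_le_one₀ (Real.sqrt_nonneg y) h1 (n := n)
    have : 0 ≤ |y| ^ n := by positivity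
    linarith
  · have h1 : Real.sqrt y ≤ |y| := by
      rw [Real.sqrt_le_left (abs_nonneg y)]
      nlinarith [le_abs_self y]
    have := pow_le_pow_left₀ (Real.sqrt_nonneg y) h1 n
    linarith

theorem integrable_neg_sqrt_pow (μ : Measure ℝ) [IsFiniteMeasure μ] (n : ℕ)
    (h : Integrable (fun x => x ^ n) μ) : Integrable (fun y => (-Real.sqrt y) ^ n) μ := by
  simp only [neg_pow (Real.sqrt _)]
  exact (integrable_sqrt_pow μ n h).const_mul _

theorem integrable_pow_symmSqrt (μ : Measure ℝ) [IsFiniteMeasure μ] (n : ℕ)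
    (h : Integrable (fun x => x ^ n) μ) : Integrable (fun x => x ^ n) (symmSqrt μ) := by
  refine Integrable.smul_measure (.add_measure ?_ ?_) (by simp)
  · exact (integrable_map_measure (continuous_pow n).aestronglyMeasurable
      Real.continuous_sqrt.measurable.aemeasurable).2 (integrable_sqrt_pow μ n h)
  · exact (integrable_map_measure (continuous_pow n).aestronglyMeasurable
      measurable_neg_sqrt.aemeasurable).2 (integrable_neg_sqrt_pow μ n h)

theorem integral_pow_symmSqrt (μ : Measure ℝ) [IsFiniteMeasure μ] (n : ℕ)
    (h : Integrable (fun x => x ^ n) μ) :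
    ∫ x, x ^ n ∂(symmSqrt μ) = (1 + (-1) ^ n) / 2 * ∫ y, Real.sqrt y ^ n ∂μ := by
  have hc : ∀ ρ : Measure ℝ, AEStronglyMeasurable (fun x : ℝ => x ^ n) ρ := fun ρ =>
    (continuous_pow n).aestronglyMeasurable
  rw [symmSqrt, integral_smul_measure, integral_add_measure,
    integral_map Real.continuous_sqrt.measurable.aemeasurable (hc _),
    integral_map measurable_neg_sqrt.aemeasurable (hc _)]
  · simp only [neg_pow (Real.sqrt _), integral_const_mul, ENNReal.toReal_inv,
      ENNReal.toReal_ofNat, smul_eq_mul]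
    ring
  · exact (integrable_map_measure (hc _)
      Real.continuous_sqrt.measurable.aemeasurable).2 (integrable_sqrt_pow μ n h)
  · exact (integrable_map_measure (hc _)
      measurable_neg_sqrt.aemeasurable).2 (integrable_neg_sqrt_pow μ n h)

theorem integral_even_pow_symmSqrt (μ : Measure ℝ) [IsFiniteMeasure μ] (hμ : μ (Iio 0) = 0)
    (n : ℕ) (h : Integrable (fun x => x ^ (2 * n)) μ) :
    ∫ x, x ^ (2 * n) ∂(symmSqrt μ) = ∫ y, y ^ n ∂μ := by
  rw [integral_pow_symmSqrt μ _ h, pow_mul (-1 : ℝ), neg_one_sq, one_pow, one_add_one_eq_two,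
    div_self two_ne_zero, one_mul]
  refine integral_congr_ae ?_
  filter_upwards [ae_nonneg_of_measure_Iio_eq_zero hμ] with y hy
  rw [pow_mul, Real.sq_sqrt hy]

/-- **Carleman's criterion** for the Stieltjes moment problem. -/
theorem isMomentDetOnNonneg_of_carleman (μ : Measure ℝ) [IsProbabilityMeasure μ]
    (hsupp : μ (Iio 0) = 0) (hmom : ∀ n : ℕ, Integrable (fun x => x ^ n) μ)
    (hsum : Tendsto (fun N : ℕ => ∑ n ∈ Finset.Icc 1 N,
      (∫ x, x ^ n ∂μ) ^ (-(1 : ℝ) / (2 * n))) atTop atTop) : IsMomentDetOnNonneg μ := by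
  intro ν hν hνsupp hνmom
  have hνint : ∀ n : ℕ, Integrable (fun x => x ^ n) ν := by
    intro n
    rcases Nat.eq_zero_or_pos n with rfl | hn
    · simp
    · exact (hνmom n hn).1
  have hνeq : ∀ n : ℕ, ∫ x, x ^ n ∂ν = ∫ x, x ^ n ∂μ := by
    intro n
    rcases Nat.eq_zero_or_pos n with rfl | hn
    · simp
    · exact (hνmom n hn).2
  have hS : symmSqrt μ = symmSqrt ν := by
    refine eq_of_carleman_hamburger _ _ (fun n => integrable_pow_symmSqrt μ n (hmom n))
      (fun n => integrable_pow_symmSqrt ν n (hνint n)) (fun n => ?_) ?_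
    · obtain ⟨k, rfl | rfl⟩ := n.even_or_odd'
      · rw [integral_even_pow_symmSqrt μ hsupp k (hmom _),
          integral_even_pow_symmSqrt ν hνsupp k (hνint _), hνeq]
      · rw [integral_pow_symmSqrt μ _ (hmom _), integral_pow_symmSqrt ν _ (hνint _),
          Odd.neg_one_pow ⟨k, rfl⟩]
        simp
    · simpa only [integral_even_pow_symmSqrt μ hsupp _ (hmom _)] using hsum
  rw [← map_sq_symmSqrt μ hsupp, hS, map_sq_symmSqrt ν hνsupp]

theorem not_summable_inv_mul_log_succ :
    ¬ Summable fun n : ℕ => ((n : ℝ) * Real.log (n + 1))⁻¹ := by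
  rw [← summable_condensed_iff_of_nonneg]
  · intro h
    have hharm : Summable fun k : ℕ => (1 : ℝ) / ((k : ℝ) + 1) := by
      refine (h.mul_left (Real.log 2)).of_nonneg_of_le (fun k => by positivity) fun k => ?_
      have h2 : (1 : ℝ) ≤ 2 ^ k := one_le_pow₀ one_le_two
      have hlog : Real.log (2 ^ k + 1) ≤ ((k : ℝ) + 1) * Real.log 2 := by
        calc Real.log (2 ^ k + 1) ≤ Real.log (2 ^ (k + 1)) :=
              Real.log_le_log (by positivity) (by rw [pow_succ]; linarith)
          _ = _ := by rw [Real.log_pow]; push_cast; ring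
      have hlog0 : 0 < Real.log (2 ^ k + 1) := Real.log_pos (by linarith)
      have hl2 : 0 < Real.log 2 := Real.log_pos one_lt_two
      push_cast
      rw [mul_inv, ← mul_assoc ((2 : ℝ) ^ k), mul_inv_cancel₀ (by positivity), one_mul,
        ← div_eq_mul_inv, div_le_div_iff₀ (by positivity) hlog0]
      linarith
    refine Real.not_summable_one_div_natCast ((summable_nat_add_iff 1).1 ?_)
    simpa using hharm
  · intro n
    have : 0 ≤ Real.log ((n : ℝ) + 1) := Real.log_nonneg (by linarith [n.cast_nonneg (α := ℝ)])
    positivity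
  · intro m n hm hmn
    have hm' : (1 : ℝ) ≤ m := by exact_mod_cast hm
    have hmn' : (m : ℝ) ≤ n := by exact_mod_cast hmn
    have h1 : 0 < Real.log ((m : ℝ) + 1) := Real.log_pos (by linarith)
    have h2 : Real.log ((m : ℝ) + 1) ≤ Real.log ((n : ℝ) + 1) :=
      Real.log_le_log (by linarith) (by linarith)
    exact inv_anti₀ (by positivity) (by gcongr)

/-- Carleman's condition holds if the `n`-th moment is `O(n log n) ^ (2 * n)`. -/
theorem tendsto_carleman_sum_of_le (s : ℕ → ℝ) (B : ℝ) (hB : 0 < B) (hs : ∀ n, 0 < s n)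
    (hle : ∀ n : ℕ, 2 ≤ n → s n ≤ (B * (n * Real.log (n + 1))) ^ (2 * n)) :
    Tendsto (fun N : ℕ => ∑ n ∈ Finset.Icc 1 N, s n ^ (-(1 : ℝ) / (2 * n))) atTop atTop := by
  have hterm : ∀ n : ℕ, 0 ≤ s n ^ (-(1 : ℝ) / (2 * n)) := fun n => Real.rpow_nonneg (hs n).le _
  have hlow : ∀ n : ℕ, 2 ≤ n →
      B⁻¹ * ((n : ℝ) * Real.log (n + 1))⁻¹ ≤ s n ^ (-(1 : ℝ) / (2 * n)) := by
    intro n hn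
    have hn' : (2 : ℝ) ≤ n := by exact_mod_cast hn
    have hlog : 0 < Real.log ((n : ℝ) + 1) := Real.log_pos (by linarith)
    have hbase : 0 < B * (n * Real.log ((n : ℝ) + 1)) := by positivity
    have h1 := Real.rpow_le_rpow_of_nonpos (hs n) (hle n hn)
      (by rw [neg_div]; exact neg_nonpos.2 (by positivity) : -(1 : ℝ) / (2 * n) ≤ 0)
    refine le_trans (le_of_eq ?_) h1
    rw [← Real.rpow_natCast, ← Real.rpow_mul hbase.le]
    have : ((2 * n : ℕ) : ℝ) * (-(1 : ℝ) / (2 * n)) = -1 := by push_cast; field_simp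
    rw [this, Real.rpow_neg_one, ← mul_inv]
  have hns : ¬ Summable fun n : ℕ => s n ^ (-(1 : ℝ) / (2 * n)) := by
    intro h
    have h2 : Summable fun n : ℕ => B⁻¹ * ((n : ℝ) * Real.log (n + 1))⁻¹ := by
      refine Summable.of_norm_bounded_eventually_nat h ?_
      filter_upwards [eventually_ge_atTop 2] with n hn
      have : 0 ≤ Real.log ((n : ℝ) + 1) := Real.log_nonneg (by linarith [n.cast_nonneg (α := ℝ)])
      rw [Real.norm_of_nonneg (by positivity)]
      exact hlow n hn
    exact not_summable_inv_mul_log_succ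
      ((summable_mul_left_iff (inv_ne_zero hB.ne')).1 h2)
  have ht := ((tendsto_add_atTop_iff_nat 1).2
    ((not_summable_iff_tendsto_nat_atTop_of_nonneg hterm).1 hns))
  have ht' := tendsto_atTop_add_const_right _ (-(s 0 ^ (-(1 : ℝ) / (2 * (0 : ℕ))))) ht
  refine ht'.congr fun N => ?_
  induction N with
  | zero => simp
  | succ N ih =>
    rw [Finset.sum_Icc_succ_top (by omega), ← ih, Finset.sum_range_succ _ (N + 1)]
    ring

/-- A self-referential estimate for truncated moments: if the density contracts by a factor under
the substitution `ψ`, the truncated moment is controlled by the weight of the substitution. -/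
theorem lintegral_pow_le_of_density_contraction
    {x₀ b : ℝ} (μ : Measure ℝ) [IsProbabilityMeasure μ] (hx₀b : x₀ ≤ b) (hb : 0 ≤ b)
    (g : ℝ → ℝ) (hg_meas : Measurable g)
    (hg_ac : μ.restrict (Ici x₀) =
      (volume.restrict (Ici x₀)).withDensity (fun x => ENNReal.ofReal (g x)))
    (hg_nonneg : ∀ x ∈ Ici b, 0 ≤ g x)
    (ψ ψ' : ℝ → ℝ) (hψ : ∀ y ∈ Ici b, HasDerivAt ψ (ψ' y) y)
    (hψ'_pos : ∀ y ∈ Ici b, 0 < ψ' y) (hψ_ge : ∀ y ∈ Ici b, y ≤ ψ y)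
    {ρ A q : ℝ} (hA : 0 ≤ A) (hq : 0 ≤ q)
    (hgψ : ∀ y ∈ Ici b, g (ψ y) ≤ ρ * g y) (n : ℕ)
    (hweight : ∀ y ∈ Ici b, ρ * (ψ' y * ψ y ^ n) ≤ A + q * y ^ n) :
    ∫⁻ y in Ici b, ENNReal.ofReal (y ^ n) ∂μ ≤
      ENNReal.ofReal (ψ b ^ n + A) +
        ENNReal.ofReal q * ∫⁻ y in Ici b, ENNReal.ofReal (y ^ n) ∂μ := by
  have hgE : Measurable fun x => ENNReal.ofReal (g x) := hg_meas.ennreal_ofReal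
  have hdens : ∀ (s : Set ℝ), MeasurableSet s → s ⊆ Ici x₀ → ∀ F : ℝ → ENNReal, Measurable F →
      ∫⁻ y in s, F y ∂μ = ∫⁻ y in s, ENNReal.ofReal (g y) * F y := by
    intro s hs hsub F hF
    have h1 : μ.restrict s = (volume.restrict s).withDensity fun x => ENNReal.ofReal (g x) := by
      rw [← Measure.restrict_restrict_of_subset hsub, hg_ac, restrict_withDensity hs,
        Measure.restrict_restrict_of_subset hsub]
    rw [h1, lintegral_withDensity_eq_lintegral_mul _ hgE hF]
    rfl
  have hpow : Measurable fun y : ℝ => ENNReal.ofReal (y ^ n) := by fun_prop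
  have hbψ : b ≤ ψ b := hψ_ge b self_mem_Ici
  have hcont : ContinuousOn ψ (Ici b) := fun y hy => (hψ y hy).continuousAt.continuousWithinAt
  have hmono : StrictMonoOn ψ (Ici b) := by
    refine strictMonoOn_of_deriv_pos (convex_Ici b) hcont fun y hy => ?_
    rw [interior_Ici] at hy
    rw [(hψ y (mem_Ici_of_Ioi hy)).deriv]
    exact hψ'_pos y (mem_Ici_of_Ioi hy)
  have himage : Ici (ψ b) ⊆ ψ '' Ici b := by
    intro z hz
    have hbz : b ≤ z := hbψ.trans hz
    obtain ⟨y, hy, rfl⟩ := intermediate_value_Icc hbz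
      (hcont.mono Icc_subset_Ici_self) ⟨hz, hψ_ge z hbz⟩
    exact ⟨y, hy.1, rfl⟩
  have hhead : ∫⁻ y in Ico b (ψ b), ENNReal.ofReal (y ^ n) ∂μ ≤ ENNReal.ofReal (ψ b ^ n) := by
    calc ∫⁻ y in Ico b (ψ b), ENNReal.ofReal (y ^ n) ∂μ
        ≤ ∫⁻ _ in Ico b (ψ b), ENNReal.ofReal (ψ b ^ n) ∂μ := by
          refine setLIntegral_mono measurable_const fun y hy => ?_
          exact ENNReal.ofReal_le_ofReal (pow_le_pow_left₀ (hb.trans hy.1) hy.2.le n)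
      _ ≤ ENNReal.ofReal (ψ b ^ n) := by
          rw [setLIntegral_const]
          exact mul_le_of_le_one_right' prob_le_one
  have htail : ∫⁻ y in Ici (ψ b), ENNReal.ofReal (y ^ n) ∂μ ≤
      ENNReal.ofReal A + ENNReal.ofReal q * ∫⁻ y in Ici b, ENNReal.ofReal (y ^ n) ∂μ := by
    calc ∫⁻ y in Ici (ψ b), ENNReal.ofReal (y ^ n) ∂μ
        = ∫⁻ y in Ici (ψ b), ENNReal.ofReal (g y) * ENNReal.ofReal (y ^ n) :=
          hdens _ measurableSet_Ici (Ici_subset_Ici.2 (hx₀b.trans hbψ)) _ hpow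
      _ ≤ ∫⁻ y in ψ '' Ici b, ENNReal.ofReal (g y) * ENNReal.ofReal (y ^ n) :=
          lintegral_mono_set himage
      _ = ∫⁻ y in Ici b, ENNReal.ofReal |ψ' y| *
            (ENNReal.ofReal (g (ψ y)) * ENNReal.ofReal (ψ y ^ n)) :=
          lintegral_image_eq_lintegral_abs_deriv_mul measurableSet_Ici
            (fun y hy => (hψ y hy).hasDerivWithinAt) hmono.injOn _
      _ ≤ ∫⁻ y in Ici b, ENNReal.ofReal (g y) *
            (ENNReal.ofReal A + ENNReal.ofReal q * ENNReal.ofReal (y ^ n)) := by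
          refine setLIntegral_mono (hgE.mul (measurable_const.add (measurable_const.mul hpow)))
            fun y hy => ?_
          have hy0 : 0 ≤ y := hb.trans hy
          have hψ0 : 0 ≤ ψ y := hy0.trans (hψ_ge y hy)
          have hd := (hψ'_pos y hy).le
          have hg0 := hg_nonneg y hy
          rw [abs_of_nonneg hd, ← ENNReal.ofReal_mul' (by positivity), ← ENNReal.ofReal_mul hd,
            ← ENNReal.ofReal_mul hq, ← ENNReal.ofReal_add hA (by positivity),
            ← ENNReal.ofReal_mul hg0]
          refine ENNReal.ofReal_le_ofReal ?_
          calc ψ' y * (g (ψ y) * ψ y ^ n) ≤ ψ' y * (ρ * g y * ψ y ^ n) := by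
                gcongr
                exact hgψ y hy
            _ = g y * (ρ * (ψ' y * ψ y ^ n)) := by ring
            _ ≤ _ := mul_le_mul_of_nonneg_left (hweight y hy) hg0
      _ = ∫⁻ y in Ici b, (ENNReal.ofReal A + ENNReal.ofReal q * ENNReal.ofReal (y ^ n)) ∂μ :=
          (hdens _ measurableSet_Ici (Ici_subset_Ici.2 hx₀b) _
            (measurable_const.add (measurable_const.mul hpow))).symm
      _ = ENNReal.ofReal A * μ (Ici b) +
            ENNReal.ofReal q * ∫⁻ y in Ici b, ENNReal.ofReal (y ^ n) ∂μ := by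
          rw [lintegral_add_left measurable_const, setLIntegral_const,
            lintegral_const_mul _ hpow]
      _ ≤ _ := by
          gcongr
          exact mul_le_of_le_one_right' prob_le_one
  calc ∫⁻ y in Ici b, ENNReal.ofReal (y ^ n) ∂μ
      = ∫⁻ y in Ico b (ψ b), ENNReal.ofReal (y ^ n) ∂μ +
          ∫⁻ y in Ici (ψ b), ENNReal.ofReal (y ^ n) ∂μ := by
        rw [← Ico_union_Ici_eq_Ici hbψ, lintegral_union measurableSet_Ici]
        exact Set.disjoint_left.2 fun y hy hy' => not_le.2 hy.2 hy'
    _ ≤ _ := add_le_add hhead htail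
    _ = _ := by
        rw [ENNReal.ofReal_add (pow_nonneg (hb.trans hbψ) n) hA, add_assoc]

/-- Consequences of the bound of `lintegral_pow_le_of_density_contraction` for the moments. -/
theorem integral_pow_le_of_density_contraction
    {x₀ b : ℝ} (μ : Measure ℝ) [IsProbabilityMeasure μ] (hsupp : μ (Iio 0) = 0)
    (hx₀b : x₀ ≤ b) (hb : 0 ≤ b)
    (g : ℝ → ℝ) (hg_meas : Measurable g)
    (hg_ac : μ.restrict (Ici x₀) =
      (volume.restrict (Ici x₀)).withDensity (fun x => ENNReal.ofReal (g x)))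
    (hg_nonneg : ∀ x ∈ Ici b, 0 ≤ g x)
    (ψ ψ' : ℝ → ℝ) (hψ : ∀ y ∈ Ici b, HasDerivAt ψ (ψ' y) y)
    (hψ'_pos : ∀ y ∈ Ici b, 0 < ψ' y) (hψ_ge : ∀ y ∈ Ici b, y ≤ ψ y)
    {ρ A q : ℝ} (hA : 0 ≤ A) (hq : 0 ≤ q) (hq1 : q < 1)
    (hgψ : ∀ y ∈ Ici b, g (ψ y) ≤ ρ * g y) (n : ℕ)
    (hweight : ∀ y ∈ Ici b, ρ * (ψ' y * ψ y ^ n) ≤ A + q * y ^ n)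
    (hint : Integrable (fun x => x ^ n) μ) :
    ∫ y, y ^ n ∂μ ≤ b ^ n + (ψ b ^ n + A) / (1 - q) := by
  have hψb : 0 ≤ ψ b := hb.trans (hψ_ge b self_mem_Ici)
  have h := lintegral_pow_le_of_density_contraction μ hx₀b hb g hg_meas hg_ac hg_nonneg ψ ψ' hψ
    hψ'_pos hψ_ge hA hq hgψ n hweight
  have hI : 0 ≤ ∫ y in Ici b, y ^ n ∂μ :=
    setIntegral_nonneg measurableSet_Ici fun y hy => pow_nonneg (hb.trans hy) n
  rw [← ofReal_integral_eq_lintegral_ofReal hint.integrableOn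
      (by filter_upwards [ae_restrict_mem measurableSet_Ici] with y hy
          exact pow_nonneg (hb.trans hy) n),
    ← ENNReal.ofReal_mul hq, ← ENNReal.ofReal_add (by positivity) (by positivity),
    ENNReal.ofReal_le_ofReal_iff (by positivity)] at h
  have htail : ∫ y in Ici b, y ^ n ∂μ ≤ (ψ b ^ n + A) / (1 - q) := by
    rw [le_div_iff₀ (by linarith)]
    linarith
  have hhead : ∫ y in Iio b, y ^ n ∂μ ≤ b ^ n := by
    calc ∫ y in Iio b, y ^ n ∂μ ≤ ∫ _ in Iio b, b ^ n ∂μ := by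
          refine integral_mono_ae hint.integrableOn (integrable_const _) ?_
          filter_upwards [ae_restrict_mem measurableSet_Iio,
            ae_restrict_of_ae (ae_nonneg_of_measure_Iio_eq_zero hsupp)] with y hy hy0
          exact pow_le_pow_left₀ hy0 (le_of_lt hy) n
      _ ≤ b ^ n := by
          rw [setIntegral_const, smul_eq_mul]
          exact mul_le_of_le_one_left (pow_nonneg hb n) measureReal_le_one
  rw [← integral_add_compl measurableSet_Iio hint, compl_Iio]
  exact add_le_add hhead htail

theorem hasDerivAt_shift_log_rpow (a α : ℝ) {y : ℝ} (hy : 1 < Real.sqrt y) :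
    HasDerivAt (fun y => (Real.sqrt y + a * Real.log (Real.sqrt y) ^ α) ^ 2)
      ((Real.sqrt y + a * Real.log (Real.sqrt y) ^ α) / Real.sqrt y *
        (1 + a * α * Real.log (Real.sqrt y) ^ (α - 1) / Real.sqrt y)) y := by
  have hx0 : Real.sqrt y ≠ 0 := by positivity
  have hy0 : y ≠ 0 := fun h => hx0 (by rw [h, Real.sqrt_zero])
  have hlog : Real.log (Real.sqrt y) ≠ 0 := (Real.log_pos hy).ne'
  have h1 := Real.hasDerivAt_sqrt hy0
  have h2 := ((h1.log hx0).rpow_const (p := α) (Or.inl hlog)).const_mul a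
  refine ((h1.add h2).pow 2).congr_deriv ?_
  simp only [Pi.add_apply]
  field_simp
  ring

/-- The weight of the substitution `y ↦ (√y + a (log √y) ^ α) ^ 2` in the `n`-th moment. -/
theorem shift_log_rpow_weight_le {a α : ℝ} (ha : 0 < a) (hα : α ∈ Icc (0 : ℝ) 1) {x : ℝ}
    (hx : Real.exp 1 ≤ x) (n : ℕ) :
    (x + a * Real.log x ^ α) / x * (1 + a * α * Real.log x ^ (α - 1) / x) *
        ((x + a * Real.log x ^ α) ^ 2) ^ n ≤
      (x ^ 2) ^ n * (1 + a * (Real.log x / x)) ^ (2 * n + 2) := by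
  have hx0 : 0 < x := (Real.exp_pos 1).trans_le hx
  have hlog : 1 ≤ Real.log x := by rwa [Real.le_log_iff_exp_le hx0]
  have hα0 := hα.1
  have h1 : Real.log x ^ α ≤ Real.log x := by
    simpa using Real.rpow_le_rpow_of_exponent_le hlog hα.2
  have h2 : α * Real.log x ^ (α - 1) ≤ Real.log x := by
    have : Real.log x ^ (α - 1) ≤ 1 :=
      Real.rpow_le_one_of_one_le_of_nonpos hlog (by linarith [hα.2])
    have h0 : 0 ≤ Real.log x ^ (α - 1) := by positivity
    nlinarith [hα.2]
  have hA : x + a * Real.log x ^ α ≤ x * (1 + a * (Real.log x / x)) := by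
    calc x + a * Real.log x ^ α ≤ x + a * Real.log x := by gcongr
      _ = _ := by field_simp
  have hB : 1 + a * α * Real.log x ^ (α - 1) / x ≤ 1 + a * (Real.log x / x) := by
    rw [← mul_div_assoc a (Real.log x), mul_assoc a]
    gcongr
  have hA' : (x + a * Real.log x ^ α) / x ≤ 1 + a * (Real.log x / x) := by
    rwa [div_le_iff₀' hx0]
  have hpow0 : 0 ≤ Real.log x ^ α := by positivity
  calc _ ≤ (1 + a * (Real.log x / x)) * (1 + a * (Real.log x / x)) *
        ((x * (1 + a * (Real.log x / x))) ^ 2) ^ n := by gcongr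
    _ = _ := by
      rw [mul_pow, mul_pow, ← pow_mul (1 + a * (Real.log x / x)), pow_add _ (2 * n)]
      ring

/-- Splitting the weight at the truncation level `T`, beyond which it is at most `ρ ^ (-1 / 2)`. -/
theorem truncated_weight_le {a ρ x T : ℝ} (ha : 0 < a) (hρ : 0 < ρ) (hρ1 : ρ < 1)
    (hx : Real.exp 1 ≤ x) (hT : Real.exp 1 ≤ T) (n : ℕ)
    (hsmall : (2 * n + 2) * a * (Real.log T / T) ≤ -Real.log ρ / 2) :
    ρ * ((x ^ 2) ^ n * (1 + a * (Real.log x / x)) ^ (2 * n + 2)) ≤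
      (T ^ 2) ^ n * (1 + a) ^ (2 * n + 2) + Real.exp (Real.log ρ / 2) * (x ^ 2) ^ n := by
  have hx0 : 0 < x := (Real.exp_pos 1).trans_le hx
  have hT0 : 0 < T := (Real.exp_pos 1).trans_le hT
  have hlog : 1 ≤ Real.log x := by rwa [Real.le_log_iff_exp_le hx0]
  rcases le_total x T with h | h
  · have h1 : Real.log x / x ≤ 1 := by
      rw [div_le_one hx0]
      linarith [Real.log_le_sub_one_of_pos hx0]
    have h2 : (x ^ 2) ^ n * (1 + a * (Real.log x / x)) ^ (2 * n + 2) ≤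
        (T ^ 2) ^ n * (1 + a) ^ (2 * n + 2) := by
      gcongr
      nlinarith
    have h3 : 0 ≤ (x ^ 2) ^ n * (1 + a * (Real.log x / x)) ^ (2 * n + 2) := by positivity
    have h4 : 0 ≤ Real.exp (Real.log ρ / 2) * (x ^ 2) ^ n := by positivity
    nlinarith
  · have h1 : Real.log x / x ≤ Real.log T / T := Real.log_div_self_antitoneOn hT hx h
    have h2 : (1 + a * (Real.log x / x)) ^ (2 * n + 2) ≤ Real.exp (-Real.log ρ / 2) := by
      calc (1 + a * (Real.log x / x)) ^ (2 * n + 2)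
          ≤ Real.exp (a * (Real.log x / x)) ^ (2 * n + 2) := by
            gcongr
            rw [add_comm]
            exact Real.add_one_le_exp _
        _ = Real.exp ((2 * n + 2) * a * (Real.log x / x)) := by
            rw [← Real.exp_nat_mul]
            congr 1
            push_cast
            ring
        _ ≤ Real.exp ((2 * n + 2) * a * (Real.log T / T)) := by gcongr
        _ ≤ _ := Real.exp_le_exp.2 hsmall
    have h3 : ρ * Real.exp (-Real.log ρ / 2) = Real.exp (Real.log ρ / 2) := by
      conv_lhs => rw [← Real.exp_log hρ, Real.log_exp, ← Real.exp_add]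
      congr 1
      ring
    have h4 : 0 ≤ (T ^ 2) ^ n * (1 + a) ^ (2 * n + 2) := by positivity
    calc _ ≤ ρ * ((x ^ 2) ^ n * Real.exp (-Real.log ρ / 2)) := by gcongr
      _ = ρ * Real.exp (-Real.log ρ / 2) * (x ^ 2) ^ n := by ring
      _ = Real.exp (Real.log ρ / 2) * (x ^ 2) ^ n := by rw [h3]
      _ ≤ _ := le_add_of_nonneg_left h4

/-- A truncation level of order `n log n` satisfies the hypotheses of `truncated_weight_le`. -/
theorem exists_truncation_scale {a δ : ℝ} (ha : 0 < a) (hδ : 0 < δ) :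
    ∃ L : ℝ, Real.exp 1 ≤ L ∧ ∀ n : ℕ, 2 ≤ n →
      Real.exp 1 ≤ L * (n * Real.log (n + 1)) ∧
      (2 * n + 2) * a * (Real.log (L * (n * Real.log (n + 1))) /
        (L * (n * Real.log (n + 1)))) ≤ δ := by
  have ho : (fun L : ℝ => Real.log L + 2) =o[atTop] (id : ℝ → ℝ) :=
    Real.isLittleO_log_id_atTop.add (Asymptotics.isLittleO_const_id_atTop (2 : ℝ))
  obtain ⟨L, hL, hLe⟩ := ((ho.bound (show 0 < δ / (4 * a) by positivity)).and
    (eventually_ge_atTop (Real.exp 1))).exists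
  refine ⟨L, hLe, fun n hn => ?_⟩
  have hL0 : 0 < L := (Real.exp_pos 1).trans_le hLe
  have hlogL : 1 ≤ Real.log L := by rwa [Real.le_log_iff_exp_le hL0]
  have hn' : (2 : ℝ) ≤ n := by exact_mod_cast hn
  have hl : 1 ≤ Real.log ((n : ℝ) + 1) := by
    rw [Real.le_log_iff_exp_le (by linarith)]
    linarith [Real.exp_one_lt_three]
  set l := Real.log ((n : ℝ) + 1) with hldef
  have hl0 : 0 < l := by linarith
  have hlogT : Real.log (L * (n * l)) ≤ (Real.log L + 2) * l := by
    rw [Real.log_mul hL0.ne' (by positivity), Real.log_mul (by positivity) (by positivity)]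
    have h1 : Real.log n ≤ l := Real.log_le_log (by linarith) (by linarith)
    have h2 : Real.log l ≤ l := Real.log_le_self hl0.le
    nlinarith
  rw [Real.norm_of_nonneg (by linarith), id, Real.norm_of_nonneg hL0.le] at hL
  have hTL : L ≤ L * (n * l) := le_mul_of_one_le_right hL0.le (by nlinarith)
  refine ⟨hLe.trans hTL, ?_⟩
  calc (2 * n + 2) * a * (Real.log (L * (n * l)) / (L * (n * l)))
      ≤ (4 * n) * a * ((δ / (4 * a) * L * l) / (L * (n * l))) := by
        have hlog0 : 0 ≤ Real.log (L * (n * l)) :=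
          Real.log_nonneg (by linarith [hlogL.trans (Real.log_le_self hL0.le)])
        gcongr ?_ * a * (?_ / _)
        · linarith
        · exact hlogT.trans (by gcongr)
    _ = δ := by field_simp

/-- Corollary 4: if `limsup_{x→∞} g((x + a (log x)^α)²)/g(x²) < 1` with `a > 0`,
`α ∈ [0,1]`, `x₀ > 1`, then `∑ ν_n^{-1/(2n)} = ∞` and `G` is M-det on `[0,∞)`. -/
theorem corollary4
    (x₀ : ℝ) (hx₀ : 1 < x₀)
    (a α : ℝ) (ha : 0 < a) (hα : α ∈ Icc (0 : ℝ) 1)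
    (μ : Measure ℝ) [IsProbabilityMeasure μ]
    (hsupp : μ (Iio 0) = 0)
    (hmom : ∀ n : ℕ, Integrable (fun x => x ^ n) μ)
    (g : ℝ → ℝ) (hg_meas : Measurable g)
    (hg_ac : μ.restrict (Ici x₀) =
      (volume.restrict (Ici x₀)).withDensity (fun x => ENNReal.ofReal (g x)))
    (hg_pos : ∀ x ∈ Ici x₀, 0 < g x)
    (hlimsup : Filter.limsup
        (fun x => ENNReal.ofReal (g ((x + a * (Real.log x) ^ α) ^ 2) / g (x ^ 2)))
        atTop < 1) :
    Tendsto (fun N : ℕ => ∑ n ∈ Finset.Icc 1 N,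
        (∫ x, x ^ n ∂μ) ^ (-(1 : ℝ) / (2 * n))) atTop atTop ∧
    IsMomentDetOnNonneg μ := by
  suffices hsum : Tendsto (fun N : ℕ => ∑ n ∈ Finset.Icc 1 N,
      (∫ x, x ^ n ∂μ) ^ (-(1 : ℝ) / (2 * n))) atTop atTop from
    ⟨hsum, isMomentDetOnNonneg_of_carleman μ hsupp hmom hsum⟩
  obtain ⟨c, hc, hc1⟩ := exists_between hlimsup
  have hc_top : c ≠ ⊤ := (hc1.trans ENNReal.one_lt_top).ne
  set ρ := c.toReal with hρdef
  have hρ : 0 < ρ := ENNReal.toReal_pos (zero_le.trans_lt hc).ne' hc_top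
  have hρ1 : ρ < 1 := by
    simpa using (ENNReal.toReal_lt_toReal hc_top ENNReal.one_ne_top).2 hc1
  obtain ⟨X, hX⟩ := eventually_atTop.1
    ((eventually_lt_of_limsup_lt hc).and (eventually_ge_atTop (max x₀ (Real.exp 1))))
  have hX_ge := (hX X le_rfl).2
  have hXx₀ : x₀ ≤ X := (le_max_left _ _).trans hX_ge
  have hXe : Real.exp 1 ≤ X := (le_max_right _ _).trans hX_ge
  have hX1 : 1 < X := hx₀.trans_le hXx₀
  set b : ℝ := X ^ 2 with hb
  have hx₀b : x₀ ≤ b := by nlinarith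
  have hb0 : 0 ≤ b := by positivity
  have hsqrt : ∀ y ∈ Ici b, X ≤ Real.sqrt y := fun y hy => Real.le_sqrt_of_sq_le hy
  have hsq : ∀ y ∈ Ici b, Real.sqrt y ^ 2 = y := fun y hy => Real.sq_sqrt (hb0.trans hy)
  set ψ : ℝ → ℝ := fun y => (Real.sqrt y + a * Real.log (Real.sqrt y) ^ α) ^ 2 with hψdef
  have hlogpow : ∀ (β : ℝ), ∀ y ∈ Ici b, 0 ≤ Real.log (Real.sqrt y) ^ β := fun β y hy =>
    Real.rpow_nonneg (Real.log_nonneg (hX1.le.trans (hsqrt y hy))) β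
  have hψ_ge : ∀ y ∈ Ici b, y ≤ ψ y := by
    intro y hy
    conv_lhs => rw [← hsq y hy]
    have := mul_nonneg ha.le (hlogpow α y hy)
    exact pow_le_pow_left₀ (Real.sqrt_nonneg y) (by linarith) 2
  have hgψ : ∀ y ∈ Ici b, g (ψ y) ≤ ρ * g y := by
    intro y hy
    have h := (hX _ (hsqrt y hy)).1
    rw [hsq y hy] at h
    have hgy : 0 < g y := hg_pos y (hx₀b.trans hy)
    rw [← div_le_iff₀ hgy]
    exact ((le_max_left _ _).trans_eq ENNReal.toReal_ofReal'.symm).trans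
      (ENNReal.toReal_mono hc_top h.le)
  set q : ℝ := Real.exp (Real.log ρ / 2) with hqdef
  have hlogρ : Real.log ρ < 0 := Real.log_neg hρ hρ1
  have hq1 : q < 1 := by
    rw [hqdef, ← Real.exp_zero]
    exact Real.exp_lt_exp.2 (by linarith)
  have hq0 : 0 < q := Real.exp_pos _
  obtain ⟨L, hLe, hL⟩ := exists_truncation_scale ha (show 0 < -Real.log ρ / 2 by linarith)
  have hL0 : 0 < L := (Real.exp_pos 1).trans_le hLe
  set P : ℝ := b + ψ b + (1 + a) ^ 4 with hP
  have hψb : 0 ≤ ψ b := hb0.trans (hψ_ge b self_mem_Ici)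
  have ha4 : 0 < (1 + a) ^ 4 := by positivity
  have hP0 : 0 < P := by positivity
  set D : ℝ := 3 * P / (1 - q) with hD
  have h1q : 0 < 1 - q := by linarith
  have hD0 : 0 < D := by positivity
  refine tendsto_carleman_sum_of_le (fun n => ∫ x, x ^ n ∂μ) (Real.sqrt D * L) (by positivity)
    (fun n => ?_) fun n hn => ?_
  · have hae := ae_nonneg_of_measure_Iio_eq_zero hsupp
    refine (integral_nonneg_of_ae (by filter_upwards [hae] with y hy
                                      exact pow_nonneg hy n)).lt_of_ne' fun h0 => ?_
    have hzero := (integral_eq_zero_iff_of_nonneg_ae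
      (by filter_upwards [hae] with y hy; exact pow_nonneg hy n) (hmom n)).1 h0
    have hIci : μ.restrict (Ici x₀) = 0 := by
      rw [Measure.restrict_eq_zero]
      refine measure_mono_null (fun y hy => ?_) (ae_iff.1 hzero)
      have hy1 : 0 < y := by linarith [show x₀ ≤ y from hy]
      exact (pow_pos hy1 n).ne'
    rw [hg_ac, withDensity_eq_zero_iff hg_meas.ennreal_ofReal.aemeasurable] at hIci
    have hfalse : ∀ᵐ y ∂(volume.restrict (Ici x₀)), False := by
      filter_upwards [hIci, ae_restrict_mem measurableSet_Ici] with y hy hmem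
      exact absurd (ENNReal.ofReal_eq_zero.1 hy) (not_le.2 (hg_pos y hmem))
    rw [eventually_false_iff_eq_bot, ae_eq_bot, Measure.restrict_eq_zero, Real.volume_Ici] at hfalse
    exact ENNReal.top_ne_zero hfalse
  · obtain ⟨hT, hsmall⟩ := hL n hn
    set T : ℝ := L * (n * Real.log (n + 1)) with hTdef
    have hT1 : 1 ≤ T := (by linarith [Real.add_one_le_exp 1] : (1 : ℝ) ≤ Real.exp 1).trans hT
    have hA0 : 0 ≤ (T ^ 2) ^ n * (1 + a) ^ (2 * n + 2) := by positivity
    have hmain := integral_pow_le_of_density_contraction μ hsupp hx₀b hb0 g hg_meas hg_ac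
      (fun y hy => (hg_pos y (hx₀b.trans hy)).le) ψ _
      (fun y hy => hasDerivAt_shift_log_rpow a α (hX1.trans_le (hsqrt y hy)))
      (fun y hy => by
        have h0 : 0 < Real.sqrt y := by linarith [hsqrt y hy]
        have h1 := hlogpow α y hy
        have h2 := hlogpow (α - 1) y hy
        have h3 := hα.1
        positivity) hψ_ge hA0 hq0.le hq1 hgψ n
      (fun y hy => by
        have hy' : Real.exp 1 ≤ Real.sqrt y := hXe.trans (hsqrt y hy)
        have h1 := shift_log_rpow_weight_le ha hα hy' n
        have h2 := truncated_weight_le ha hρ hρ1 hy' hT n hsmall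
        have h3 := (mul_le_mul_of_nonneg_left h1 hρ.le).trans h2
        rwa [hsq y hy] at h3) (hmom n)
    have hTn : (1 : ℝ) ≤ (T ^ 2) ^ n := one_le_pow₀ (one_le_pow₀ hT1)
    have hbP : b ^ n ≤ P ^ n := pow_le_pow_left₀ hb0 (by linarith) n
    have hψP : ψ b ^ n ≤ P ^ n := pow_le_pow_left₀ hψb (by linarith) n
    have haP : (1 + a) ^ (2 * n + 2) ≤ P ^ n := by
      calc (1 + a) ^ (2 * n + 2) ≤ (1 + a) ^ (4 * n) :=
            pow_le_pow_right₀ (by linarith) (by omega)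
        _ = ((1 + a) ^ 4) ^ n := pow_mul _ _ _
        _ ≤ P ^ n := pow_le_pow_left₀ ha4.le (by linarith) n
    have hPn : 0 < P ^ n := by positivity
    calc ∫ x, x ^ n ∂μ ≤ b ^ n + (ψ b ^ n + (T ^ 2) ^ n * (1 + a) ^ (2 * n + 2)) / (1 - q) := hmain
      _ ≤ b ^ n / (1 - q) + (ψ b ^ n + (T ^ 2) ^ n * (1 + a) ^ (2 * n + 2)) / (1 - q) := by
          gcongr
          exact le_div_self (by positivity) h1q (by linarith)
      _ = (b ^ n + ψ b ^ n + (T ^ 2) ^ n * (1 + a) ^ (2 * n + 2)) / (1 - q) := by ring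
      _ ≤ (3 * ((T ^ 2) ^ n * P ^ n)) / (1 - q) := by
          gcongr
          nlinarith
      _ = 3 / (1 - q) * (P ^ n * (T ^ 2) ^ n) := by ring
      _ ≤ (3 / (1 - q)) ^ n * (P ^ n * (T ^ 2) ^ n) := by
          gcongr
          refine le_self_pow₀ ?_ (by omega)
          rw [one_le_div h1q]
          linarith
      _ = (Real.sqrt D * L * (n * Real.log (n + 1))) ^ (2 * n) := by
          rw [mul_assoc (Real.sqrt D), ← hTdef, pow_mul, mul_pow (Real.sqrt D), Real.sq_sqrt hD0.le,
            ← mul_pow, ← mul_pow, hD]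
          congr 1
          ring
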